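/- arXiv:2603.05709 — 2 statements merged into one kernel-verified Lean document; each statement's English description precedes it below -/
import Mathlib

section
/- Let C, Ĉ ∈ ℂ^{n×n} be unit lower triangular matrices and let D, D̂ ∈ ℝ^{n×n} be nonnegative diagonal matrices. Set A = C⁻¹·D·C⁻* and Â = Ĉ⁻¹·D̂·Ĉ⁻*. If A and Â have the same range (as linear maps ℂⁿ → ℂⁿ), then for every i ∈ {1,…,n}, D(i,i) > 0 if and only if D̂(i,i) > 0. -/
open Matrix

/-- A unit lower triangular complex matrix: ones on the diagonal,
zeros strictly above the diagonal. -/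
def UnitLowerTri {n : ℕ} (C : Matrix (Fin n) (Fin n) ℂ) : Prop :=
  (∀ i, C i i = 1) ∧ ∀ i j : Fin n, i < j → C i j = 0

theorem ult_det {n : ℕ} {C : Matrix (Fin n) (Fin n) ℂ} (hC : UnitLowerTri C) :
    IsUnit C.det := by
  rw [Matrix.det_of_lowerTriangular C (fun i j h => hC.2 i j h)]
  simp [hC.1]

theorem ult_mulVec {n : ℕ} {C : Matrix (Fin n) (Fin n) ℂ} (hC : UnitLowerTri C)
    (v : Fin n → ℂ) (i : Fin n) (hv : ∀ j < i, v j = 0) : (C *ᵥ v) i = v i := by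
  rw [Matrix.mulVec, dotProduct, Finset.sum_eq_single i]
  · simp [hC.1]
  · intro j _ hj
    rcases lt_or_gt_of_ne hj with h | h
    · simp [hv j h]
    · simp [hC.2 i j h]
  · simp

theorem ult_aux {n : ℕ} (C Chat : Matrix (Fin n) (Fin n) ℂ)
    (hC : UnitLowerTri C) (hChat : UnitLowerTri Chat)
    (d dh : Fin n → ℝ) (hdh : ∀ i, 0 ≤ dh i)
    (A Ahat : Matrix (Fin n) (Fin n) ℂ)
    (hA : A = C⁻¹ * Matrix.diagonal (fun i => (d i : ℂ)) * (C⁻¹)ᴴ)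
    (hAhat : Ahat = Chat⁻¹ * Matrix.diagonal (fun i => (dh i : ℂ)) * (Chat⁻¹)ᴴ)
    (hrange : LinearMap.range A.mulVecLin = LinearMap.range Ahat.mulVecLin)
    (i : Fin n) (hi : 0 < d i) : 0 < dh i := by
  have hdet := ult_det hC
  have hdet2 := ult_det hChat
  have hdi : (d i : ℂ) ≠ 0 := by exact_mod_cast hi.ne'
  set v : Fin n → ℂ := C⁻¹ *ᵥ Pi.single i 1 with hv
  have hCv : C *ᵥ v = Pi.single i 1 := by
    rw [hv, Matrix.mulVec_mulVec, Matrix.mul_nonsing_inv _ hdet, Matrix.one_mulVec]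
  have hlow : ∀ j, j < i → v j = 0 := by
    intro j
    induction j using WellFoundedLT.induction with
    | ind j ih =>
      intro hj
      rw [← ult_mulVec hC v j (fun k hk => ih k hk (hk.trans hj)), hCv]
      simp [hj.ne]
  have hvi : v i = 1 := by
    rw [← ult_mulVec hC v i hlow, hCv]; simp
  have hmem : v ∈ LinearMap.range A.mulVecLin := by
    refine ⟨Cᴴ *ᵥ Pi.single i (d i : ℂ)⁻¹, ?_⟩
    have h1 : (C⁻¹)ᴴ * Cᴴ = 1 := by
      rw [← Matrix.conjTranspose_mul, Matrix.mul_nonsing_inv _ hdet, Matrix.conjTranspose_one]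
    rw [Matrix.mulVecLin_apply, Matrix.mulVec_mulVec, hA, Matrix.mul_assoc, h1, Matrix.mul_one,
      ← Matrix.mulVec_mulVec, hv]
    congr 1
    ext k
    rw [Matrix.mulVec_diagonal]
    by_cases hk : k = i
    · subst hk; simp [hdi]
    · simp [hk]
  rw [hrange] at hmem
  obtain ⟨u, hu⟩ := hmem
  have h2 : (Chat *ᵥ v) i = 1 := by rw [ult_mulVec hChat v i hlow, hvi]
  rw [← hu, Matrix.mulVecLin_apply, Matrix.mulVec_mulVec, hAhat, Matrix.mul_assoc,
    ← Matrix.mul_assoc, Matrix.mul_nonsing_inv _ hdet2, Matrix.one_mul, ← Matrix.mulVec_mulVec,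
    Matrix.mulVec_diagonal] at h2
  refine lt_of_le_of_ne (hdh i) ?_
  intro h0
  rw [← h0] at h2
  simp at h2

/-- **Matching diagonal supports of equirange inverse Cholesky
decompositions.**  If `A = C⁻¹·D·C⁻ᴴ` and `Â = Ĉ⁻¹·D̂·Ĉ⁻ᴴ` with `C, Ĉ`
unit lower triangular and `D, D̂` nonnegative diagonal, and `A` and `Â` have
the same range, then `D(i,i) > 0 ↔ D̂(i,i) > 0` for every `i`. -/
theorem diag_support_eq_of_range_eq
    (n : ℕ)
    (C Chat : Matrix (Fin n) (Fin n) ℂ)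
    (hC : UnitLowerTri C) (hChat : UnitLowerTri Chat)
    (d dh : Fin n → ℝ) (hd : ∀ i, 0 ≤ d i) (hdh : ∀ i, 0 ≤ dh i)
    (A Ahat : Matrix (Fin n) (Fin n) ℂ)
    (hA : A = C⁻¹ * Matrix.diagonal (fun i => (d i : ℂ)) * (C⁻¹)ᴴ)
    (hAhat : Ahat = Chat⁻¹ * Matrix.diagonal (fun i => (dh i : ℂ)) * (Chat⁻¹)ᴴ)
    (hrange : LinearMap.range A.mulVecLin = LinearMap.range Ahat.mulVecLin) :
    ∀ i : Fin n, 0 < d i ↔ 0 < dh i := by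
  intro i
  exact ⟨ult_aux C Chat hC hChat d dh hdh A Ahat hA hAhat hrange i,
    ult_aux Chat C hChat hC dh d hd Ahat A hAhat hA hrange.symm i⟩
end

section
/- Let C, Ĉ ∈ ℂ^{n×n} be unit lower triangular, let D, D̂ ∈ ℝ^{n×n} be nonnegative diagonal matrices, and set A = C⁻¹·D·C⁻* and Â = Ĉ⁻¹·D̂·Ĉ⁻*. If A and Â have the same range, then vol(A) · ∏_{i : D̂(i,i)>0} D̂(i,i) = vol(Â) · ∏_{i : D(i,i)>0} D(i,i), where vol denotes the product of the strictly positive eigenvalues of a Hermitian positive-semidefinite matrix. -/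
open Matrix

/-- The volume of a Hermitian matrix: the product of its strictly positive
eigenvalues (counted with multiplicity). -/
noncomputable def vol {n : ℕ} {A : Matrix (Fin n) (Fin n) ℂ}
    (hA : A.IsHermitian) : ℝ :=
  ∏ i ∈ Finset.univ.filter (fun i => 0 < hA.eigenvalues i), hA.eigenvalues i

theorem aux_tri_mul {n : ℕ} {X Y : Matrix (Fin n) (Fin n) ℂ}
    (hX : ∀ i j : Fin n, i < j → X i j = 0) (hY : ∀ i j : Fin n, i < j → Y i j = 0) :
    (∀ i j : Fin n, i < j → (X * Y) i j = 0) ∧ ∀ i, (X * Y) i i = X i i * Y i i := by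
  constructor
  · intro i j hij
    rw [Matrix.mul_apply]
    refine Finset.sum_eq_zero fun k _ => ?_
    rcases lt_or_ge i k with h | h
    · rw [hX i k h, zero_mul]
    · rw [hY k j (lt_of_le_of_lt h hij), mul_zero]
  · intro i
    rw [Matrix.mul_apply]
    refine Finset.sum_eq_single i (fun k _ hk => ?_) (by simp)
    rcases lt_or_gt_of_ne hk with h | h
    · rw [hY k i h, mul_zero]
    · rw [hX i k h, zero_mul]

theorem aux_det {n : ℕ} {C : Matrix (Fin n) (Fin n) ℂ} (hC : UnitLowerTri C) : C.det = 1 := by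
  rw [Matrix.det_of_lowerTriangular C (fun i j h => hC.2 i j h)]
  simp [hC.1]

theorem aux_inv {n : ℕ} {C : Matrix (Fin n) (Fin n) ℂ} (hC : UnitLowerTri C) :
    UnitLowerTri C⁻¹ := by
  have hu : IsUnit C.det := by rw [aux_det hC]; exact isUnit_one
  haveI : Invertible C := Matrix.invertibleOfIsUnitDet C hu
  have hB : C.BlockTriangular OrderDual.toDual := fun i j h => hC.2 i j h
  have hB' := Matrix.blockTriangular_inv_of_blockTriangular hB
  have h2 : ∀ i j : Fin n, i < j → C⁻¹ i j = 0 := fun i j h => hB' h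
  refine ⟨fun i => ?_, h2⟩
  have := (aux_tri_mul hC.2 h2).2 i
  rw [Matrix.mul_nonsing_inv C hu, hC.1 i] at this
  simpa using this.symm

theorem aux_mul {n : ℕ} {X Y : Matrix (Fin n) (Fin n) ℂ} (hX : UnitLowerTri X)
    (hY : UnitLowerTri Y) : UnitLowerTri (X * Y) :=
  ⟨fun i => by rw [(aux_tri_mul hX.2 hY.2).2, hX.1, hY.1, mul_one],
    (aux_tri_mul hX.2 hY.2).1⟩

theorem aux_vol {n : ℕ} {A : Matrix (Fin n) (Fin n) ℂ} (hA : A.IsHermitian)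
    (hnn : ∀ i, 0 ≤ hA.eigenvalues i) :
    ∃ Q B : Matrix (Fin n) (Fin n) ℂ, Qᴴ = Q ∧ A * B = 1 - Q ∧ Q * A = 0 ∧
      (A + Q).det = (vol hA : ℂ) := by
  obtain ⟨U, V, hUV, hVU, hVs, hs⟩ : ∃ U V : Matrix (Fin n) (Fin n) ℂ, U * V = 1 ∧ V * U = 1 ∧
      Uᴴ = V ∧ A = U * Matrix.diagonal (fun i => (hA.eigenvalues i : ℂ)) * V := by
    refine ⟨hA.eigenvectorUnitary, star (hA.eigenvectorUnitary : Matrix (Fin n) (Fin n) ℂ),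
      Unitary.mul_star_self_of_mem hA.eigenvectorUnitary.2,
      Unitary.star_mul_self_of_mem hA.eigenvectorUnitary.2, rfl, ?_⟩
    have := hA.spectral_theorem
    rw [Unitary.conjStarAlgAut_apply] at this
    exact this
  have hVs' : Vᴴ = U := by rw [← hVs, Matrix.conjTranspose_conjTranspose]
  set l := hA.eigenvalues with hl
  let q : Fin n → ℂ := fun i => if 0 < l i then 0 else 1
  let b : Fin n → ℂ := fun i => ((l i)⁻¹ : ℝ)
  have hmul : ∀ X Y : Matrix (Fin n) (Fin n) ℂ, (U * X * V) * (U * Y * V) = U * (X * Y) * V := by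
    intro X Y
    calc (U * X * V) * (U * Y * V) = U * X * (V * U) * Y * V := by noncomm_ring
      _ = _ := by rw [hVU]; noncomm_ring
  have h1 : U * 1 * V = 1 := by rw [mul_one, hUV]
  refine ⟨U * Matrix.diagonal q * V, U * Matrix.diagonal b * V, ?_, ?_, ?_, ?_⟩
  · rw [Matrix.conjTranspose_mul, Matrix.conjTranspose_mul, hVs, hVs',
      Matrix.diagonal_conjTranspose, Matrix.mul_assoc]
    congr 3
    ext i; simp only [q, Pi.star_apply]; split_ifs <;> simp
  · rw [hs, hmul]
    conv_rhs => rw [← h1, ← sub_mul, ← mul_sub]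
    congr 2
    rw [Matrix.diagonal_mul_diagonal, ← Matrix.diagonal_one, Matrix.diagonal_sub]
    congr 1; ext i
    simp only [q, b]
    split_ifs with h
    · have : (l i : ℂ) ≠ 0 := by exact_mod_cast h.ne'
      push_cast; simp [this]
    · have : l i = 0 := le_antisymm (not_lt.1 h) (hnn i)
      simp [this]
  · rw [hs, hmul, Matrix.diagonal_mul_diagonal]
    have : (fun i => q i * (l i : ℂ)) = fun _ => 0 := by
      ext i
      simp only [q]
      split_ifs with h
      · simp
      · have : l i = 0 := le_antisymm (not_lt.1 h) (hnn i)
        simp [this]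
    rw [this]; simp
  · have e : A + U * Matrix.diagonal q * V
        = U * Matrix.diagonal (fun i => (l i : ℂ) + q i) * V := by
      rw [← Matrix.diagonal_add, mul_add, add_mul, ← hs]
    have hd : U.det * V.det = 1 := by rw [← Matrix.det_mul, hUV, Matrix.det_one]
    rw [e, Matrix.det_mul, Matrix.det_mul, Matrix.det_diagonal, mul_right_comm, hd, one_mul, vol,
      Finset.prod_filter]
    push_cast
    refine Finset.prod_congr rfl fun i _ => ?_
    simp only [q, ← hl]
    split_ifs with h
    · simp
    · have : l i = 0 := le_antisymm (not_lt.1 h) (hnn i)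
      simp [this]

theorem aux_entry {n : ℕ} {C Chat : Matrix (Fin n) (Fin n) ℂ}
    (hC : UnitLowerTri C) (hChat : UnitLowerTri Chat) {d dh : Fin n → ℝ}
    {A Ahat : Matrix (Fin n) (Fin n) ℂ}
    (hA : A = C⁻¹ * Matrix.diagonal (fun i => (d i : ℂ)) * (C⁻¹)ᴴ)
    (hAhat : Ahat = Chat⁻¹ * Matrix.diagonal (fun i => (dh i : ℂ)) * (Chat⁻¹)ᴴ)
    {X : Matrix (Fin n) (Fin n) ℂ} (hX : A = Ahat * X)
    (i j : Fin n) (hj : 0 < d j) (hi : dh i = 0) : (Chat * C⁻¹) i j = 0 := by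
  have hu : C⁻¹ * C = 1 := Matrix.nonsing_inv_mul C (by rw [aux_det hC]; exact isUnit_one)
  have hu' : Chat * Chat⁻¹ = 1 :=
    Matrix.mul_nonsing_inv Chat (by rw [aux_det hChat]; exact isUnit_one)
  have hs : (C⁻¹)ᴴ * Cᴴ = 1 := by
    rw [← Matrix.conjTranspose_mul, Matrix.mul_nonsing_inv C (by rw [aux_det hC]; exact isUnit_one),
      Matrix.conjTranspose_one]
  have key : (Chat * C⁻¹) * Matrix.diagonal (fun i => (d i : ℂ))
      = Matrix.diagonal (fun i => (dh i : ℂ)) * ((Chat⁻¹)ᴴ * X * Cᴴ) := by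
    calc _ = Chat * (C⁻¹ * Matrix.diagonal (fun i => (d i : ℂ)) * ((C⁻¹)ᴴ * Cᴴ)) := by
            rw [hs]; noncomm_ring
      _ = Chat * A * Cᴴ := by rw [hA]; noncomm_ring
      _ = (Chat * Chat⁻¹) * (Matrix.diagonal (fun i => (dh i : ℂ)) * ((Chat⁻¹)ᴴ * X * Cᴴ)) := by
            rw [hX, hAhat]; noncomm_ring
      _ = _ := by rw [hu', one_mul]
  have := congrFun (congrFun key i) j
  rw [Matrix.mul_diagonal, Matrix.diagonal_mul, hi] at this
  have hne : (d j : ℂ) ≠ 0 := by exact_mod_cast hj.ne'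
  simpa [hne] using this

theorem aux_factor {n : ℕ} {A B : Matrix (Fin n) (Fin n) ℂ}
    (h : LinearMap.range A.mulVecLin ≤ LinearMap.range B.mulVecLin) : ∃ X, A = B * X := by
  have : ∀ j, ∃ v, B *ᵥ v = A.col j := by
    intro j
    have : A.col j ∈ LinearMap.range B.mulVecLin := h ⟨Pi.single j 1, by simp⟩
    simpa using this
  choose f hf using this
  refine ⟨Matrix.of fun i j => f j i, ?_⟩
  ext i j
  have := congrFun (hf j) i
  simp only [Matrix.col_apply] at this
  rw [← this]
  rfl

theorem aux_core {n : ℕ} {M Mi N N' P D E Dp Ei Q A Ah : Matrix (Fin n) (Fin n) ℂ}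
    (hMM : Mi * M = 1) (hMM' : M * Mi = 1)
    (hA : A = M * (N * D * Nᴴ) * Mᴴ) (hAh : Ah = M * E * Mᴴ)
    (hPs : Pᴴ = P) (hPDP : D = P * D * P) (hPDp : Dp * P = D) (hEi : Ei * E = P)
    (hEEi : E * Ei = P) (hPE : P * E = E)
    (hD1 : (1 - P) * Dp = 1 - P) (hE1 : (1 - P) * Ei = 1 - P)
    (hNP : N' * P = N * P) (hPN : P * N' = N' * P) (hN1 : (1 - P) * N' = 1 - P)
    (hQA : Q * Ah = 0) (hQQ : Q * Q = Q) (hN'd : N'.det = 1) :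
    (A + Q).det * Ei.det⁻¹ = (Ah + Q).det * Dp.det ∨ Ei.det = 0 := by
  by_cases hE0 : Ei.det = 0
  · exact Or.inr hE0
  left
  have hNs : N'ᴴ * P = P * N'ᴴ := by
    have := congrArg Matrix.conjTranspose hPN
    simpa [Matrix.conjTranspose_mul, hPs] using this
  have hNs1 : (1 - P) * N'ᴴ = 1 - P := by
    have h3 : N' * (1 - P) = 1 - P := by
      rw [mul_sub, ← hPN, ← hN1, sub_mul]; simp
    have := congrArg Matrix.conjTranspose h3
    simpa [Matrix.conjTranspose_mul, hPs] using this
  have hPN2 : P * N'ᴴ = P * Nᴴ := by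
    have := congrArg Matrix.conjTranspose hNP
    simpa [Matrix.conjTranspose_mul, hPs] using this
  obtain ⟨F, hF⟩ : ∃ F, F = N' * Dp * N'ᴴ * Ei := ⟨_, rfl⟩
  have hFE : F * E = N * D * Nᴴ := by
    calc F * E = N' * Dp * (N'ᴴ * (Ei * E)) := by rw [hF]; noncomm_ring
      _ = N' * (Dp * P) * N'ᴴ := by rw [hEi, hNs]; noncomm_ring
      _ = (N' * P) * D * (P * N'ᴴ) := by rw [hPDp]; conv_lhs => rw [hPDP]
                                         noncomm_ring
      _ = N * (P * D * P) * Nᴴ := by rw [hNP, hPN2]; noncomm_ring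
      _ = _ := by rw [← hPDP]
  have hF1 : (1 - P) * F = 1 - P := by
    rw [hF, ← mul_assoc, ← mul_assoc, ← mul_assoc, hN1, hD1, hNs1, hE1]
  have hF2 : P * (F - 1) = F - 1 := by
    have : (1 - P) * (F - 1) = 0 := by rw [mul_sub, hF1]; simp
    rw [sub_mul, one_mul, sub_eq_zero] at this
    exact this.symm
  have hss : Mᴴ * Miᴴ = 1 := by rw [← Matrix.conjTranspose_mul, hMM, Matrix.conjTranspose_one]
  have hQMP : Q * M * P = 0 := by
    calc Q * M * P = Q * (M * E * (Mᴴ * Miᴴ)) * Ei := by rw [hss, ← hEEi]; noncomm_ring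
      _ = Q * Ah * Miᴴ * Ei := by rw [hAh]; noncomm_ring
      _ = 0 := by rw [hQA]; simp
  have hQMF : Q * M * (F - 1) = 0 := by rw [← hF2, ← mul_assoc, hQMP, zero_mul]
  obtain ⟨R, hR⟩ : ∃ R, R = M * (F - 1) * Mi := ⟨_, rfl⟩
  have hQR : (1 - Q) * R = R := by
    have : Q * R = 0 := by rw [hR, ← mul_assoc, ← mul_assoc, hQMF, zero_mul]
    rw [sub_mul, this]; simp
  have hRA : R * Ah = A - Ah := by
    calc R * Ah = M * (F - 1) * (Mi * M) * E * Mᴴ := by rw [hR, hAh]; noncomm_ring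
      _ = M * (F * E) * Mᴴ - M * E * Mᴴ := by rw [hMM]; noncomm_ring
      _ = _ := by rw [hFE, hA, hAh]
  have hS : (1 + R * (1 - Q)) * (Ah + Q) = A + Q := by
    calc _ = Ah + Q + R * Ah - R * (Q * Ah) + (R * Q - R * (Q * Q)) := by noncomm_ring
      _ = _ := by rw [hQA, hQQ, hRA]; simp only [mul_zero, sub_zero, sub_self, add_zero]; abel
  have hdet : (1 + R * (1 - Q)).det = F.det := by
    rw [Matrix.det_one_add_mul_comm, hQR]
    have : 1 + R = M * F * Mi := by
      rw [hR, mul_sub, sub_mul, mul_one, hMM']; abel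
    have hd : M.det * Mi.det = 1 := by rw [← Matrix.det_mul, hMM', Matrix.det_one]
    rw [this, Matrix.det_mul, Matrix.det_mul, mul_right_comm, hd, one_mul]
  have hFd : F.det = Dp.det * Ei.det := by
    rw [hF, Matrix.det_mul, Matrix.det_mul, Matrix.det_mul, Matrix.det_conjTranspose, hN'd]; simp
  rw [← hS, Matrix.det_mul, hdet, hFd]
  field_simp

open scoped ComplexOrder in
theorem aux_psd {n : ℕ} (L A : Matrix (Fin n) (Fin n) ℂ) {d : Fin n → ℝ} (hd : ∀ i, 0 ≤ d i)
    (h : A = L * Matrix.diagonal (fun i => (d i : ℂ)) * Lᴴ) (hA : A.IsHermitian) :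
    ∀ i, 0 ≤ hA.eigenvalues i := by
  have : A.PosSemidef := by
    rw [h]
    apply Matrix.PosSemidef.mul_mul_conjTranspose_same
    exact Matrix.PosSemidef.diagonal (fun i => by simpa using hd i)
  exact this.eigenvalues_nonneg

/-- **Volume ratio formula.**  If `A = C⁻¹·D·C⁻ᴴ` and `Â = Ĉ⁻¹·D̂·Ĉ⁻ᴴ` are
inverse Cholesky decompositions with the same range, then
`vol(A) · ∏_{D̂(i,i)>0} D̂(i,i) = vol(Â) · ∏_{D(i,i)>0} D(i,i)`
(equivalently `vol(A)/vol(Â) = vol(D)/vol(D̂)`). -/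
theorem vol_ratio_of_range_eq
    (n : ℕ)
    (C Chat : Matrix (Fin n) (Fin n) ℂ)
    (hC : UnitLowerTri C) (hChat : UnitLowerTri Chat)
    (d dh : Fin n → ℝ) (hd : ∀ i, 0 ≤ d i) (hdh : ∀ i, 0 ≤ dh i)
    (A Ahat : Matrix (Fin n) (Fin n) ℂ)
    (hA : A = C⁻¹ * Matrix.diagonal (fun i => (d i : ℂ)) * (C⁻¹)ᴴ)
    (hAhat : Ahat = Chat⁻¹ * Matrix.diagonal (fun i => (dh i : ℂ)) * (Chat⁻¹)ᴴ)
    (hAH : A.IsHermitian) (hAhatH : Ahat.IsHermitian)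
    (hrange : LinearMap.range A.mulVecLin = LinearMap.range Ahat.mulVecLin) :
    vol hAH * ∏ i ∈ Finset.univ.filter (fun i => 0 < dh i), dh i
      = vol hAhatH * ∏ i ∈ Finset.univ.filter (fun i => 0 < d i), d i := by
  have hu : IsUnit C.det := by rw [aux_det hC]; exact isUnit_one
  have huh : IsUnit Chat.det := by rw [aux_det hChat]; exact isUnit_one
  have hpA := aux_psd _ _ hd hA hAH
  have hpAh := aux_psd _ _ hdh hAhat hAhatH
  obtain ⟨X, hX⟩ := aux_factor hrange.le
  obtain ⟨Y, hY⟩ := aux_factor hrange.ge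
  have hN := aux_mul hChat (aux_inv hC)
  have hN2 := aux_mul hC (aux_inv hChat)
  have ent := aux_entry hC hChat hA hAhat hX
  have ent2 := aux_entry hChat hC hAhat hA hY
  have hJ : ∀ i, 0 < d i ↔ 0 < dh i := by
    intro i
    constructor
    · intro h
      by_contra h'
      have := ent i i h (le_antisymm (not_lt.1 h') (hdh i))
      rw [hN.1 i] at this
      exact one_ne_zero this
    · intro h
      by_contra h'
      have := ent2 i i h (le_antisymm (not_lt.1 h') (hd i))
      rw [hN2.1 i] at this
      exact one_ne_zero this
  have ent' : ∀ i j, 0 < d j → ¬ 0 < d i → (Chat * C⁻¹) i j = 0 := fun i j h h' =>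
    ent i j h (le_antisymm (not_lt.1 (fun h2 => h' ((hJ i).2 h2))) (hdh i))
  have hd0 : ∀ i, ¬ 0 < d i → d i = 0 := fun i h => le_antisymm (not_lt.1 h) (hd i)
  have hdh0 : ∀ i, ¬ 0 < d i → dh i = 0 := fun i h =>
    le_antisymm (not_lt.1 (fun h2 => h ((hJ i).2 h2))) (hdh i)
  have hdhne : ∀ i, 0 < d i → (dh i : ℂ) ≠ 0 := fun i h => by
    exact_mod_cast ((hJ i).1 h).ne'
  obtain ⟨Q, B, hQs, hAB, hQA, hdetA⟩ := aux_vol hAH hpA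
  obtain ⟨Q', B', hQs', hAB', hQA', hdetA'⟩ := aux_vol hAhatH hpAh
  have hQAh : Q * Ahat = 0 := by rw [hY, ← mul_assoc, hQA, zero_mul]
  have hQAh' : Q' * A = 0 := by rw [hX, ← mul_assoc, hQA', zero_mul]
  have e1 : Q * Q' = Q := by
    have : Q * (1 - Q') = 0 := by rw [← hAB', ← mul_assoc, hQAh, zero_mul]
    rw [mul_sub, mul_one, sub_eq_zero] at this
    exact this.symm
  have e2 : Q' * Q = Q' := by
    have : Q' * (1 - Q) = 0 := by rw [← hAB, ← mul_assoc, hQAh', zero_mul]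
    rw [mul_sub, mul_one, sub_eq_zero] at this
    exact this.symm
  have e3 : Q' = Q := by
    have := congrArg Matrix.conjTranspose e1
    rw [Matrix.conjTranspose_mul, hQs, hQs', e2] at this
    exact this
  subst e3
  obtain ⟨p, hp⟩ : ∃ p : Fin n → ℂ, p = fun i => if 0 < d i then 1 else 0 := ⟨_, rfl⟩
  obtain ⟨dp, hdp⟩ : ∃ p : Fin n → ℂ, p = fun i => if 0 < d i then (d i : ℂ) else 1 := ⟨_, rfl⟩
  obtain ⟨ei, hei⟩ : ∃ p : Fin n → ℂ, p = fun i => if 0 < d i then (dh i : ℂ)⁻¹ else 1 :=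
    ⟨_, rfl⟩
  obtain ⟨N, hNdef⟩ : ∃ N, N = Chat * C⁻¹ := ⟨_, rfl⟩
  rw [← hNdef] at hN ent'
  obtain ⟨N', hN'def⟩ : ∃ N' : Matrix (Fin n) (Fin n) ℂ, N' = Matrix.diagonal p * N *
    Matrix.diagonal p + (1 - Matrix.diagonal p) := ⟨_, rfl⟩
  have hPP : Matrix.diagonal p * Matrix.diagonal p = Matrix.diagonal p := by
    rw [Matrix.diagonal_mul_diagonal]; congr 1; ext i; simp [hp]
  have hPNP : Matrix.diagonal p * N * Matrix.diagonal p = N * Matrix.diagonal p := by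
    ext i j
    rw [Matrix.mul_diagonal, Matrix.mul_diagonal, Matrix.diagonal_mul]
    by_cases hj : 0 < d j
    · by_cases hi : 0 < d i
      · simp [hp, hi]
      · simp [ent' i j hj hi]
    · simp [hp, hj]
  have hN'P : N' * Matrix.diagonal p = N * Matrix.diagonal p := by
    rw [hN'def, add_mul, hPNP, mul_assoc, hPP, sub_mul, hPP]; simp
  have hPN' : Matrix.diagonal p * N' = N * Matrix.diagonal p := by
    rw [hN'def, mul_add, mul_sub, hPP, mul_assoc, ← mul_assoc, hPP, ← mul_assoc, hPNP]; simp
  have hN'tri : UnitLowerTri N' := by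
    constructor
    · intro i
      rw [hN'def, Matrix.add_apply, Matrix.mul_diagonal, Matrix.diagonal_mul, hN.1]
      by_cases hi : 0 < d i <;> simp [hp, hi]
    · intro i j hij
      rw [hN'def, Matrix.add_apply, Matrix.mul_diagonal, Matrix.diagonal_mul, hN.2 i j hij]
      simp [hij.ne]
  have hQQ : Q' * Q' = Q' := e1
  have core := aux_core (M := Chat⁻¹) (Mi := Chat) (N := N) (N' := N')
    (P := Matrix.diagonal p) (D := Matrix.diagonal (fun i => (d i : ℂ)))
    (E := Matrix.diagonal (fun i => (dh i : ℂ))) (Dp := Matrix.diagonal dp)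
    (Ei := Matrix.diagonal ei) (Q := Q') (A := A) (Ah := Ahat)
    (Matrix.mul_nonsing_inv Chat huh) (Matrix.nonsing_inv_mul Chat huh)
    (by
      have : C⁻¹ = Chat⁻¹ * N := by
        rw [hNdef, ← mul_assoc, Matrix.nonsing_inv_mul Chat huh, one_mul]
      rw [hA, this, Matrix.conjTranspose_mul]; noncomm_ring)
    hAhat
    (by
      rw [Matrix.diagonal_conjTranspose]; congr 1; ext i
      by_cases hi : 0 < d i <;> simp [hp, hi])
    (by
      rw [Matrix.diagonal_mul_diagonal, Matrix.diagonal_mul_diagonal]; congr 1; ext i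
      by_cases hi : 0 < d i
      · simp [hp, hi]
      · simp [hd0 i hi])
    (by
      rw [Matrix.diagonal_mul_diagonal]; congr 1; ext i
      by_cases hi : 0 < d i
      · simp [hp, hdp, hi]
      · simp [hp, hd0 i hi])
    (by
      rw [Matrix.diagonal_mul_diagonal]; congr 1; ext i
      by_cases hi : 0 < d i
      · simp [hp, hei, hi, hdhne i hi]
      · simp [hp, hi, hdh0 i hi])
    (by
      rw [Matrix.diagonal_mul_diagonal]; congr 1; ext i
      by_cases hi : 0 < d i
      · simp [hp, hei, hi, hdhne i hi]
      · simp [hp, hi, hdh0 i hi])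
    (by
      rw [Matrix.diagonal_mul_diagonal]; congr 1; ext i
      by_cases hi : 0 < d i
      · simp [hp, hi]
      · simp [hdh0 i hi])
    (by
      rw [← Matrix.diagonal_one, Matrix.diagonal_sub, Matrix.diagonal_mul_diagonal]
      congr 1; ext i
      by_cases hi : 0 < d i <;> simp [hp, hdp, hi])
    (by
      rw [← Matrix.diagonal_one, Matrix.diagonal_sub, Matrix.diagonal_mul_diagonal]
      congr 1; ext i
      by_cases hi : 0 < d i <;> simp [hp, hei, hi])
    hN'P (hPN'.trans hN'P.symm)
    (by
      rw [sub_mul, hPN', one_mul, hN'def, hPNP]; abel)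
    hQA' hQQ (aux_det hN'tri)
  rw [Matrix.det_diagonal, Matrix.det_diagonal, hdetA, hdetA'] at core
  have hprodD : ∏ i, dp i = ((∏ i ∈ Finset.univ.filter (fun i => 0 < d i), d i : ℝ) : ℂ) := by
    rw [Finset.prod_filter]; push_cast
    refine Finset.prod_congr rfl fun i _ => ?_
    by_cases hi : 0 < d i <;> simp [hdp, hi]
  have hprodE : (∏ i, ei i)⁻¹
      = ((∏ i ∈ Finset.univ.filter (fun i => 0 < dh i), dh i : ℝ) : ℂ) := by
    rw [Finset.prod_filter, ← Finset.prod_inv_distrib]; push_cast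
    refine Finset.prod_congr rfl fun i _ => ?_
    by_cases hi : 0 < d i
    · simp [hei, hi, (hJ i).1 hi]
    · simp [hei, hi, hdh0 i hi]
  rcases core with core | core
  · rw [hprodD, hprodE] at core
    exact_mod_cast core
  · exfalso
    rw [Finset.prod_eq_zero_iff] at core
    obtain ⟨i, _, h⟩ := core
    by_cases hi : 0 < d i
    · simp [hei, hi, hdhne i hi] at h
    · simp [hei, hi] at h
end
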